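/- arXiv:2203.16900 — 2 statements merged into one kernel-verified Lean document; each statement's English description precedes it below -/
import Mathlib

section
/- Let t ≥ 4 and k ≥ 1 be integers. Every finite simple graph G that contains neither P_t nor the complement of P_t as an induced subgraph and that contains no strong configuration of order k+1 admits a partition of its vertex set into at most 4·(2t−5)^{k−1} parts, each of which induces a graph with no induced P_4. -/
/-- The path graph on `t` vertices: `i` and `j` are adjacent iff `|i - j| = 1`. -/
def pathG (t : ℕ) : SimpleGraph (Fin t) :=
  SimpleGraph.fromRel (fun i j => (i : ℕ) + 1 = (j : ℕ))

/-- `G` contains `H` as an induced subgraph. -/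
def ContainsInduced {W V : Type*} (H : SimpleGraph W) (G : SimpleGraph V) : Prop :=
  ∃ f : W → V, Function.Injective f ∧
    ∀ u v : W, u ≠ v → (G.Adj (f u) (f v) ↔ H.Adj u v)

/-- A cograph is a graph with no induced `P₄`. -/
def IsCograph {V : Type*} (G : SimpleGraph V) : Prop :=
  ¬ ContainsInduced (pathG 4) G

/-- `G` contains a strong configuration of order `k`: pairwise distinct vertices
`a_1,…,a_k` (a clique) and `b_1,…,b_k` (an independent set) such that for `i < j`,
`a_i` is adjacent to `b_j` and `b_i` is not adjacent to `a_j`. -/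
def StrongConfig {V : Type*} (G : SimpleGraph V) (k : ℕ) : Prop :=
  ∃ a b : Fin k → V,
    Function.Injective a ∧ Function.Injective b ∧
    (∀ i j : Fin k, a i ≠ b j) ∧
    (∀ i j : Fin k, i ≠ j → G.Adj (a i) (a j)) ∧
    (∀ i j : Fin k, ¬ G.Adj (b i) (b j)) ∧
    (∀ i j : Fin k, i < j → G.Adj (a i) (b j) ∧ ¬ G.Adj (b i) (a j))

/-- `S` contains no induced `P₄` of `G`; distinctness of the four vertices is automatic. -/
def P4Free {V : Type*} (G : SimpleGraph V) (S : Set V) : Prop :=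
  ∀ a ∈ S, ∀ b ∈ S, ∀ c ∈ S, ∀ d ∈ S, G.Adj a b → G.Adj b c → G.Adj c d →
    ¬ G.Adj a c → ¬ G.Adj b d → ¬ G.Adj a d → False

/-- `S` can be partitioned into at most `n` sets, each inducing a cograph. -/
def CographColorable {V : Type*} (G : SimpleGraph V) (S : Set V) (n : ℕ) : Prop :=
  ∃ c : V → ℕ, (∀ v ∈ S, c v < n) ∧ ∀ i, P4Free G {v | v ∈ S ∧ c v = i}

/-- No proper nonempty part of `S` is separated from the rest of `S`. -/
def ConnectedOn {V : Type*} (G : SimpleGraph V) (S : Set V) : Prop :=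
  ∀ A ⊆ S, A.Nonempty → A ≠ S → ∃ x ∈ A, ∃ y ∈ S, y ∉ A ∧ G.Adj x y

/-- The vertices `f 0, …, f n` form an induced path in this order. -/
def IsInducedPath {V : Type*} (G : SimpleGraph V) (f : ℕ → V) (n : ℕ) : Prop :=
  ∀ i j, i < j → j ≤ n → f i ≠ f j ∧ (G.Adj (f i) (f j) ↔ i + 1 = j)

/-- The strong configurations of order `k` with all vertices in `S`. -/
def StrongConfigOn {V : Type*} (G : SimpleGraph V) (S : Set V) (k : ℕ) : Prop :=
  ∃ a b : Fin k → V,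
    (∀ i, a i ∈ S) ∧ (∀ i, b i ∈ S) ∧
    Function.Injective b ∧
    (∀ i j : Fin k, a i ≠ b j) ∧
    (∀ i j : Fin k, i ≠ j → G.Adj (a i) (a j)) ∧
    (∀ i j : Fin k, ¬ G.Adj (b i) (b j)) ∧
    (∀ i j : Fin k, i < j → G.Adj (a i) (b j) ∧ ¬ G.Adj (b i) (a j))

/-- Every subset of `S` complete to one vertex of `S` and anticomplete to another one is
`m`-colorable by cographs. -/
def DifferencesColorable {V : Type*} (G : SimpleGraph V) (S : Set V) (m : ℕ) : Prop :=
  ∀ u ∈ S, ∀ w ∈ S, ∀ X ⊆ S, u ≠ w → w ∉ X → (∀ x ∈ X, G.Adj u x ∧ ¬ G.Adj w x) →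
    CographColorable G X m

section

variable {V : Type*} {G : SimpleGraph V} {S T : Set V} {m n : ℕ}

theorem P4Free.mono (h : P4Free G T) (hST : S ⊆ T) : P4Free G S :=
  fun a ha b hb c hc d hd => h a (hST ha) b (hST hb) c (hST hc) d (hST hd)

theorem P4Free.compl (h : P4Free G S) : P4Free Gᶜ S := by
  intro a ha b hb c hc d hd hab hbc hcd hac hbd had
  have hac' : a ≠ c := by rintro rfl; exact had hcd
  have hbd' : b ≠ d := by rintro rfl; exact had hab
  have had' : a ≠ d := by rintro rfl; exact hbd hab.symm
  simp only [SimpleGraph.compl_adj, not_and, not_not] at hab hbc hcd hac hbd had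
  exact h b hb d hd a ha c hc (hbd hbd') (had had').symm (hac hac')
    (fun h => hab.2 h.symm) (fun h => hcd.2 h.symm) hbc.2

theorem CographColorable.mono (h : CographColorable G T n) (hST : S ⊆ T) :
    CographColorable G S n := by
  obtain ⟨c, hc, hp⟩ := h
  exact ⟨c, fun v hv => hc v (hST hv), fun i => (hp i).mono fun v hv => ⟨hST hv.1, hv.2⟩⟩

theorem CographColorable.le (h : CographColorable G S m) (hmn : m ≤ n) :
    CographColorable G S n := by
  obtain ⟨c, hc, hp⟩ := h
  exact ⟨c, fun v hv => (hc v hv).trans_le hmn, hp⟩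

theorem CographColorable.compl (h : CographColorable G S n) : CographColorable Gᶜ S n := by
  obtain ⟨c, hc, hp⟩ := h
  exact ⟨c, hc, fun i => (hp i).compl⟩

theorem cographColorable_compl : CographColorable Gᶜ S n ↔ CographColorable G S n :=
  ⟨fun h => by simpa using h.compl, fun h => h.compl⟩

theorem CographColorable.empty : CographColorable G ∅ n :=
  ⟨fun _ => 0, by simp, fun _ a ha => by simp at ha⟩

theorem P4Free.cographColorable (h : P4Free G S) : CographColorable G S 1 :=
  ⟨fun _ => 0, by simp, fun _ => h.mono fun _ hv => hv.1⟩

theorem P4Free.singleton (v : V) : P4Free G {v} := by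
  rintro a rfl b rfl c - d - hab
  exact absurd hab (G.loopless.irrefl _)

theorem CographColorable.union (hS : CographColorable G S m) (hT : CographColorable G T n) :
    CographColorable G (S ∪ T) (m + n) := by
  classical
  obtain ⟨c, hc, hp⟩ := hS
  obtain ⟨d, hd, hq⟩ := hT
  refine ⟨fun v => if v ∈ S then c v else m + d v, ?_, ?_⟩
  · rintro v hv
    by_cases h : v ∈ S
    · have := hc v h
      simp only [h, if_true]; omega
    · have := hd v (hv.resolve_left h)
      simp only [h, if_false]; omega
  · intro i
    by_cases hi : i < m
    · refine (hp i).mono ?_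
      rintro v ⟨hv, rfl⟩
      by_cases h : v ∈ S
      · simp [h]
      · simp [h] at hi
    · refine (hq (i - m)).mono ?_
      rintro v ⟨hv, rfl⟩
      by_cases h : v ∈ S
      · simp [h, hc v h] at hi
      · simp [h, hv.resolve_left h]

theorem CographColorable.of_anticomplete {A : Set V} (hA : CographColorable G A n)
    (hB : CographColorable G (S \ A) n) (h : ∀ x ∈ A, ∀ y ∈ S, y ∉ A → ¬ G.Adj x y) :
    CographColorable G S n := by
  classical
  obtain ⟨c, hc, hp⟩ := hA
  obtain ⟨d, hd, hq⟩ := hB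
  refine ⟨fun v => if v ∈ A then c v else d v, ?_, ?_⟩
  · intro v hv
    by_cases hvA : v ∈ A
    · simpa [hvA] using hc v hvA
    · simpa [hvA] using hd v ⟨hv, hvA⟩
  · intro i x hx y hy z hz w hw hxy hyz hzw
    have key : ∀ {p q}, p ∈ S → q ∈ S → G.Adj p q → (p ∈ A ↔ q ∈ A) := fun hp hq hpq =>
      ⟨fun hpA => by_contra fun hqA => h _ hpA _ hq hqA hpq,
        fun hqA => by_contra fun hpA => h _ hqA _ hp hpA hpq.symm⟩
    have h1 := key hx.1 hy.1 hxy
    have h2 := key hy.1 hz.1 hyz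
    have h3 := key hz.1 hw.1 hzw
    by_cases hxA : x ∈ A
    · have hyA := h1.1 hxA
      have hzA := h2.1 hyA
      have hwA := h3.1 hzA
      refine hp i x ⟨hxA, ?_⟩ y ⟨hyA, ?_⟩ z ⟨hzA, ?_⟩ w ⟨hwA, ?_⟩ hxy hyz hzw
      · simpa [hxA] using hx.2
      · simpa [hyA] using hy.2
      · simpa [hzA] using hz.2
      · simpa [hwA] using hw.2
    · have hyA := mt h1.2 hxA
      have hzA := mt h2.2 hyA
      have hwA := mt h3.2 hzA
      refine hq i x ⟨⟨hx.1, hxA⟩, ?_⟩ y ⟨⟨hy.1, hyA⟩, ?_⟩ z ⟨⟨hz.1, hzA⟩, ?_⟩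
        w ⟨⟨hw.1, hwA⟩, ?_⟩ hxy hyz hzw
      · simpa [hxA] using hx.2
      · simpa [hyA] using hy.2
      · simpa [hzA] using hz.2
      · simpa [hwA] using hw.2

/-- If `S` is not `n`-colorable by cographs, then neither is some component of `S`. -/
theorem exists_component_not_cographColorable [Finite V] (hS : ¬ CographColorable G S n) :
    ∃ Y ⊆ S, ConnectedOn G Y ∧ ¬ CographColorable G Y n ∧
      ∀ x ∈ Y, ∀ y ∈ S, y ∉ Y → ¬ G.Adj x y := by
  induction S using WellFoundedLT.induction with
  | ind S ih =>
    by_cases hconn : ConnectedOn G S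
    · exact ⟨S, subset_rfl, hconn, hS, fun x _ y hy hy' => absurd hy hy'⟩
    · unfold ConnectedOn at hconn
      push Not at hconn
      obtain ⟨A, hAS, hne, hneS, hsep⟩ := hconn
      by_cases hA : CographColorable G A n
      · have hB : ¬ CographColorable G (S \ A) n := fun hB => hS (hA.of_anticomplete hB hsep)
        have hlt : S \ A < S := by
          refine Set.sdiff_subset.lt_of_ne fun h => ?_
          obtain ⟨x, hx⟩ := hne
          exact (h.symm ▸ hAS hx : x ∈ S \ A).2 hx
        obtain ⟨Y, hY, hconn, hcol, hYsep⟩ := ih _ hlt hB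
        refine ⟨Y, hY.trans Set.sdiff_subset, hconn, hcol, fun x hx y hy hyY hxy => ?_⟩
        by_cases hyA : y ∈ A
        · exact hsep y hyA x (hY hx).1 (hY hx).2 hxy.symm
        · exact hYsep x hx y ⟨hy, hyA⟩ hyY hxy
      · obtain ⟨Y, hY, hconn, hcol, hYsep⟩ := ih A (hAS.lt_of_ne hneS) hA
        refine ⟨Y, hY.trans hAS, hconn, hcol, fun x hx y hy hyY hxy => ?_⟩
        by_cases hyA : y ∈ A
        · exact hYsep x hx y hyA hyY hxy
        · exact hsep x (hY hx) y hy hyA hxy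

theorem IsInducedPath.cons {f : ℕ → V} {u : V} (hf : IsInducedPath G f n)
    (hu : G.Adj u (f 0)) (h : ∀ i, 1 ≤ i → i ≤ n → f i ≠ u ∧ ¬ G.Adj u (f i)) :
    IsInducedPath G (fun i => Nat.casesOn i u f) (n + 1) := by
  intro i j hij hj
  obtain _ | j := j
  · omega
  obtain _ | i := i
  · obtain _ | j := j
    · exact ⟨hu.ne, by simpa using hu⟩
    · have := h (j + 1) (by omega) (by omega)
      exact ⟨this.1.symm, by simpa using this.2⟩
  · simpa using hf i j (by omega) (by omega)

theorem IsInducedPath.containsInduced {f : ℕ → V} {t : ℕ} (hf : IsInducedPath G f (t - 1)) :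
    ContainsInduced (pathG t) G := by
  refine ⟨fun i => f i, fun i j hij => ?_, fun u v huv => ?_⟩
  · by_contra hne
    rcases lt_or_gt_of_ne hne with h | h
    · exact (hf i j h (by omega)).1 hij
    · exact (hf j i h (by omega)).1 hij.symm
  · have huv' : (u : ℕ) ≠ v := fun h => huv (Fin.ext h)
    simp only [pathG, SimpleGraph.fromRel_adj]
    rcases lt_or_gt_of_ne huv with h | h
    · rw [(hf u v h (by omega)).2]
      have : (u : ℕ) < v := h
      constructor
      · exact fun h => ⟨huv, .inl h⟩
      · rintro ⟨-, h | h⟩ <;> omega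
    · rw [G.adj_comm, (hf v u h (by omega)).2]
      have : (v : ℕ) < u := h
      constructor
      · exact fun h => ⟨huv, .inr h⟩
      · rintro ⟨-, h | h⟩ <;> omega

theorem ContainsInduced.compl {W : Type*} {H : SimpleGraph W} (h : ContainsInduced H G) :
    ContainsInduced Hᶜ Gᶜ := by
  obtain ⟨f, hf, h⟩ := h
  refine ⟨f, hf, fun u v huv => ?_⟩
  simp [SimpleGraph.compl_adj, huv, hf.ne huv, h u v huv]

theorem DifferencesColorable.mono (h : DifferencesColorable G T m) (hST : S ⊆ T) :
    DifferencesColorable G S m :=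
  fun u hu w hw X hX => h u (hST hu) w (hST hw) X (hX.trans hST)

theorem DifferencesColorable.compl (h : DifferencesColorable G S m) :
    DifferencesColorable Gᶜ S m := by
  intro u hu w hw X hX huw hwX hadj
  refine (h w hw u hu X hX huw.symm (fun huX => (hadj u huX).1.ne rfl) fun x hx => ?_).compl
  have := hadj x hx
  simp only [SimpleGraph.compl_adj, not_and, not_not] at this
  exact ⟨this.2 fun h => hwX (h ▸ hx), this.1.2⟩

/-- A Gyárfás path starting at `u` and continuing in `C`, where `r` is a vertex
anticomplete to `C`. -/
theorem exists_isInducedPath [Finite V] (hG : DifferencesColorable G S m) {r : V} (hr : r ∈ S)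
    (j : ℕ) {C : Set V} {u : V} (hu : u ∈ S) (hCS : C ⊆ S) (huC : u ∉ C) (hur : u ≠ r)
    (hnb : ∃ x ∈ C, G.Adj u x) (hC : ConnectedOn G C) (hrC : r ∉ C)
    (hanti : ∀ x ∈ C, ¬ G.Adj r x) (hcol : ¬ CographColorable G C (j * m)) :
    ∃ f : ℕ → V, f 0 = u ∧ (∀ i, 1 ≤ i → i ≤ j + 1 → f i ∈ C) ∧ IsInducedPath G f (j + 1) := by
  induction j generalizing C u with
  | zero =>
    obtain ⟨x, hx, hux⟩ := hnb
    refine ⟨fun i => Nat.casesOn i u fun _ => x, rfl, fun i h0 h1 => ?_,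
      IsInducedPath.cons (fun i j _ _ => by omega) hux (fun i _ _ => by omega)⟩
    obtain rfl : i = 1 := by omega
    exact hx
  | succ j ih =>
    have hN : CographColorable G {x | x ∈ C ∧ G.Adj u x} m :=
      hG u hu r hr _ (fun x hx => hCS hx.1) hur (fun h => hrC h.1)
        fun x hx => ⟨hx.2, hanti x hx.1⟩
    have hM : ¬ CographColorable G {x | x ∈ C ∧ ¬ G.Adj u x} (j * m) := fun hM =>
      hcol (((hM.union hN).mono fun x hx => by
        by_cases h : G.Adj u x
        · exact .inr ⟨hx, h⟩
        · exact .inl ⟨hx, h⟩).le (by rw [add_mul, one_mul]))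
    obtain ⟨Y, hY, hconn, hYcol, hsep⟩ := exists_component_not_cographColorable hM
    have hYne : Y.Nonempty := by
      rw [Set.nonempty_iff_ne_empty]
      rintro rfl
      exact hYcol .empty
    have hYC : Y ≠ C := by
      rintro rfl
      obtain ⟨x, hx, hux⟩ := hnb
      exact (hY hx).2 hux
    obtain ⟨y, hy, z, hz, hzY, hyz⟩ := hC Y (fun x hx => (hY hx).1) hYne hYC
    have huz : G.Adj u z := by_contra fun h => hsep y hy z ⟨hz, h⟩ hzY hyz
    obtain ⟨f, hf0, hfY, hf⟩ := ih (hCS hz) (fun x hx => hCS (hY hx).1) hzY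
      (fun h => hrC (h ▸ hz)) ⟨y, hy, hyz.symm⟩ hconn (fun h => hrC (hY h).1)
      (fun x hx => hanti x (hY hx).1) hYcol
    refine ⟨_, rfl, fun i h0 h1 => ?_, hf.cons (hf0 ▸ huz) fun i h0 h1 => ?_⟩
    · obtain _ | _ | i := i
      · omega
      · simpa [hf0] using hz
      · exact (hY (hfY (i + 1) (by omega) (by omega))).1
    · have := hY (hfY i h0 h1)
      exact ⟨fun h => huC (h ▸ this.1), this.2⟩

theorem cographColorable_nonneighbors [Finite V] (hG : DifferencesColorable G S m) {t : ℕ}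
    (ht : 3 ≤ t) (hpath : ¬ ContainsInduced (pathG t) G) (hS : ConnectedOn G S) {r : V}
    (hr : r ∈ S) : CographColorable G {x | x ∈ S ∧ x ≠ r ∧ ¬ G.Adj r x} ((t - 3) * m) := by
  by_contra hM
  obtain ⟨Y, hY, hconn, hYcol, hsep⟩ := exists_component_not_cographColorable hM
  have hYne : Y.Nonempty := by
    rw [Set.nonempty_iff_ne_empty]
    rintro rfl
    exact hYcol .empty
  have hrY : r ∉ Y := fun h => (hY h).2.1 rfl
  obtain ⟨y, hy, z, hz, hzY, hyz⟩ := hS Y (fun x hx => (hY hx).1) hYne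
    (fun h => hrY (h ▸ hr))
  have hzr : z ≠ r := by
    rintro rfl
    exact (hY hy).2.2 hyz.symm
  have hrz : G.Adj r z := by_contra fun h => hsep y hy z ⟨hz, hzr, h⟩ hzY hyz
  obtain ⟨f, hf0, hfY, hf⟩ := exists_isInducedPath hG hr (t - 3) hz (fun x hx => (hY hx).1) hzY
    hzr ⟨y, hy, hyz.symm⟩ hconn hrY (fun x hx => (hY hx).2.2) hYcol
  have hlong := hf.cons (hf0 ▸ hrz) fun i h0 h1 => (hY (hfY i h0 h1)).2
  rw [show t - 3 + 1 + 1 = t - 1 by omega] at hlong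
  exact hpath hlong.containsInduced

theorem DifferencesColorable.cographColorable [Finite V] (hG : DifferencesColorable G S m)
    {t : ℕ} (ht : 3 ≤ t) (hm : 1 ≤ m) (h1 : ¬ ContainsInduced (pathG t) G)
    (h2 : ¬ ContainsInduced (pathG t)ᶜ G) : CographColorable G S ((2 * t - 5) * m) := by
  have h2' : ¬ ContainsInduced (pathG t) Gᶜ := fun h => h2 (by simpa using h.compl)
  induction S using WellFoundedLT.induction with
  | ind S ih =>
    have split : ∀ H : SimpleGraph V, ¬ ConnectedOn H S →
        (∀ A < S, CographColorable H A ((2 * t - 5) * m)) →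
        CographColorable H S ((2 * t - 5) * m) := by
      intro H hconn hcol
      by_contra hS
      obtain ⟨Y, hY, hYconn, hYcol, -⟩ := exists_component_not_cographColorable hS
      rcases hY.eq_or_lt with rfl | hlt
      · exact hconn hYconn
      · exact hYcol (hcol Y hlt)
    have ih' : ∀ A < S, CographColorable G A ((2 * t - 5) * m) :=
      fun A hA => ih A hA (hG.mono hA.le)
    by_cases hconn : ConnectedOn G S
    swap
    · exact split G hconn ih'
    by_cases hconn' : ConnectedOn Gᶜ S
    swap
    · exact cographColorable_compl.1 (split Gᶜ hconn' fun A hA => (ih' A hA).compl)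
    obtain rfl | ⟨r, hr⟩ := S.eq_empty_or_nonempty
    · exact .empty
    have hM := cographColorable_nonneighbors hG ht h1 hconn hr
    have hN := cographColorable_compl.1
      (cographColorable_nonneighbors hG.compl ht h2' hconn' hr)
    have hv := (P4Free.singleton (G := G) r).cographColorable
    refine (((hM.union hN).union hv).mono fun x hx => ?_).le ?_
    · by_cases hxr : x = r
      · exact .inr hxr
      · by_cases hadj : G.Adj r x
        · exact .inl (.inr ⟨hx, hxr, by simp [hadj]⟩)
        · exact .inl (.inl ⟨hx, hxr, hadj⟩)
    · obtain ⟨s, rfl⟩ := Nat.exists_eq_add_of_le ht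
      rw [show 2 * (3 + s) - 5 = 2 * s + 1 by omega, show 3 + s - 3 = s by omega]
      linarith

theorem StrongConfigOn.cons {X : Set V} {k : ℕ} {u w : V} (h : StrongConfigOn G X k)
    (hu : u ∈ S) (hw : w ∈ S) (hX : X ⊆ S) (huw : u ≠ w) (hwX : w ∉ X)
    (hadj : ∀ x ∈ X, G.Adj u x ∧ ¬ G.Adj w x) : StrongConfigOn G S (k + 1) := by
  obtain ⟨a, b, ha, hb, hinj, hab, hclique, hind, hlt⟩ := h
  have hwX' : ∀ x ∈ X, x ≠ w := fun x hx h => hwX (h ▸ hx)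
  refine ⟨Fin.cons u a, Fin.cons w b, ?_, ?_, ?_, ?_, ?_, ?_, ?_⟩
  · exact Fin.cases hu fun i => hX (ha i)
  · exact Fin.cases hw fun i => hX (hb i)
  · rw [Fin.cons_injective_iff]
    exact ⟨fun ⟨i, hi⟩ => hwX' _ (hb i) hi, hinj⟩
  · intro i j
    cases i using Fin.cases <;> cases j using Fin.cases
    · simpa
    · simpa using (hadj _ (hb _)).1.ne
    · simpa using hwX' _ (ha _)
    · simpa using hab _ _
  · intro i j hij
    cases i using Fin.cases <;> cases j using Fin.cases
    · exact absurd rfl hij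
    · simpa using (hadj _ (ha _)).1
    · simpa using (hadj _ (ha _)).1.symm
    · simpa using hclique _ _ fun h => hij (congrArg _ h)
  · intro i j
    cases i using Fin.cases <;> cases j using Fin.cases
    · simp
    · simpa using (hadj _ (hb _)).2
    · simpa [G.adj_comm] using (hadj _ (hb _)).2
    · simpa using hind _ _
  · intro i j hij
    cases i using Fin.cases <;> cases j using Fin.cases
    · exact absurd hij (lt_irrefl _)
    · simpa using ⟨(hadj _ (hb _)).1, (hadj _ (ha _)).2⟩
    · exact absurd hij (Fin.not_lt_zero _)
    · simpa using hlt _ _ (Fin.succ_lt_succ_iff.1 hij)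

theorem strongConfigOn_one {x y : V} (hx : x ∈ S) (hy : y ∈ S) (hxy : x ≠ y) :
    StrongConfigOn G S 1 :=
  ⟨fun _ => x, fun _ => y, fun _ => hx, fun _ => hy, Function.injective_of_subsingleton _,
    fun _ _ => hxy, fun i j h => absurd (Subsingleton.elim i j) h, by simp,
    fun i j h => absurd (Subsingleton.elim i j) h.ne⟩

theorem cographColorable_of_not_strongConfigOn_two (h : ¬ StrongConfigOn G S 2) :
    CographColorable G S 4 := by
  obtain rfl | ⟨v, hv⟩ := S.eq_empty_or_nonempty
  · exact .empty
  have key : ∀ u ∈ S, ∀ w ∈ S, ∀ x ∈ S, ∀ y ∈ S, u ≠ w → x ≠ y → w ≠ x → w ≠ y →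
      G.Adj u x → G.Adj u y → ¬ G.Adj w x → ¬ G.Adj w y → False := by
    intro u hu w hw x hx y hy huw hxy hwx hwy hux huy hwx' hwy'
    refine h ((strongConfigOn_one (S := {x, y}) (by simp) (by simp) hxy).cons hu hw ?_ huw ?_ ?_)
    · rintro z (rfl | rfl) <;> assumption
    · simp [hwx, hwy]
    · rintro z (rfl | rfl) <;> exact ⟨by assumption, by assumption⟩
  have hN : P4Free G {x | x ∈ S ∧ G.Adj v x} := by
    intro a ha b hb c hc d hd hab hbc hcd hac hbd had
    refine key v hv a ha.1 c hc.1 d hd.1 ha.2.ne hcd.ne ?_ ?_ hc.2 hd.2 hac had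
    · rintro rfl; exact had hcd
    · rintro rfl; exact hbd hab.symm
  have hM : P4Free G {x | x ∈ S ∧ x ≠ v ∧ ¬ G.Adj v x} := by
    intro a ha b hb c hc d hd hab hbc hcd hac hbd had
    refine key b hb.1 v hv a ha.1 c hc.1 hb.2.1 ?_ ha.2.1.symm hc.2.1.symm hab.symm hbc
      ha.2.2 hc.2.2
    rintro rfl; exact had hcd
  refine (((hN.cographColorable.union hM.cographColorable).union
    (P4Free.singleton v).cographColorable).mono fun x hx => ?_).le (by norm_num)
  by_cases hxv : x = v
  · exact .inr hxv
  · by_cases hadj : G.Adj v x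
    · exact .inl (.inl ⟨hx, hadj⟩)
    · exact .inl (.inr ⟨hx, hxv, hadj⟩)

theorem cographColorable_of_not_strongConfigOn [Finite V] {t : ℕ} (ht : 3 ≤ t)
    (h1 : ¬ ContainsInduced (pathG t) G) (h2 : ¬ ContainsInduced (pathG t)ᶜ G) (k : ℕ)
    (h : ¬ StrongConfigOn G S (k + 2)) : CographColorable G S (4 * (2 * t - 5) ^ k) := by
  induction k generalizing S with
  | zero => simpa using cographColorable_of_not_strongConfigOn_two h
  | succ k ih =>
    have hG : DifferencesColorable G S (4 * (2 * t - 5) ^ k) :=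
      fun u hu w hw X hX huw hwX hadj => ih fun hc => h (hc.cons hu hw hX huw hwX hadj)
    have hpos : 0 < (2 * t - 5) ^ k := Nat.pow_pos (by omega)
    exact (hG.cographColorable ht (by omega) h1 h2).le (by rw [pow_succ]; linarith)

theorem StrongConfigOn.strongConfig {k : ℕ} (h : StrongConfigOn G S k) : StrongConfig G k := by
  obtain ⟨a, b, -, -, hinj, hab, hclique, hind, hlt⟩ := h
  exact ⟨a, b, fun i j hij => by_contra fun hne => (hclique i j hne).ne hij, hinj, hab, hclique,
    hind, hlt⟩

theorem P4Free.isCograph_induce (h : P4Free G S) : IsCograph (G.induce S) := by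
  rintro ⟨f, -, hf⟩
  have adj : ∀ u v : Fin 4, u ≠ v →
      (G.Adj (f u) (f v) ↔ ((u : ℕ) + 1 = v ∨ (v : ℕ) + 1 = u)) := fun u v huv => by
    simpa [pathG, huv] using hf u v huv
  refine h (f 0) (f 0).2 (f 1) (f 1).2 (f 2) (f 2).2 (f 3) (f 3).2 ?_ ?_ ?_ ?_ ?_ ?_ <;>
    rw [adj _ _ (by decide)] <;> decide

end

theorem stmt1 (t k : ℕ) (ht : 4 ≤ t) (hk : 1 ≤ k)
    (V : Type) [Fintype V] (G : SimpleGraph V)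
    (h1 : ¬ ContainsInduced (pathG t) G)
    (h2 : ¬ ContainsInduced (pathG t)ᶜ G)
    (h3 : ¬ StrongConfig G (k + 1)) :
    ∃ c : V → Fin (4 * (2 * t - 5) ^ (k - 1)),
      ∀ i, IsCograph (G.induce (c ⁻¹' {i})) := by
  obtain ⟨k, rfl⟩ := Nat.exists_eq_add_of_le' hk
  obtain ⟨c, hc, hp⟩ := cographColorable_of_not_strongConfigOn (S := Set.univ) (by omega) h1 h2 k
    fun h => h3 h.strongConfig
  refine ⟨fun v => ⟨c v, hc v trivial⟩, fun i => P4Free.isCograph_induce ((hp i).mono ?_)⟩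
  rintro v rfl
  exact ⟨trivial, rfl⟩
end

section
/- For every pair of integers t, k ≥ 1 there exists an integer N such that the following holds. Let A and B be finite sets and let R ⊆ A × B be a relation, viewed as a bipartite graph with sides A and B in which a ∈ A and b ∈ B are adjacent iff R(a,b). Suppose this bipartite graph contains none of P_t, \tilde{P_t}, and H_k as an induced bipartite subgraph. Then there exist partitions 𝒫_A of A and 𝒫_B of B with |𝒫_A| + |𝒫_B| ≤ N such that for every X ∈ 𝒫_A and Y ∈ 𝒫_B there exists a simple graph H on the disjoint union X ⊔ Y with no induced P_4 such that for all x ∈ X and y ∈ Y, x and y are adjacent in H iff R(x,y). (This is the size part of Theorem 5; the height bounds are omitted, and 'is a bi-cograph' is expressed as being a semi-induced subgraph of a cograph.) -/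
/-- The bipartite graph `K` (with sides `X`, `Y`) appears as an induced bipartite
subgraph of the bipartite graph given by the relation `R : A → B → Prop`
(possibly with the sides swapped). -/
def BipContains {X Y A B : Type*} (K : X → Y → Prop) (R : A → B → Prop) : Prop :=
  (∃ (f : X → A) (g : Y → B), Function.Injective f ∧ Function.Injective g ∧
      ∀ x y, R (f x) (g y) ↔ K x y) ∨
  (∃ (f : X → B) (g : Y → A), Function.Injective f ∧ Function.Injective g ∧
      ∀ x y, R (g y) (f x) ↔ K x y)

/-- The path `P_t` viewed as a bipartite graph: the sides consist of the
even-indexed and the odd-indexed vertices (0-based indexing), and an even-indexed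
vertex is adjacent to an odd-indexed one iff their indices differ by 1. -/
def pathBipRel (t : ℕ) :
    {i : Fin t // i.val % 2 = 0} → {i : Fin t // i.val % 2 = 1} → Prop :=
  fun x y => x.val.val + 1 = y.val.val ∨ y.val.val + 1 = x.val.val

/-- The half-graph `H_k` as a bipartite graph: `a_i` adjacent to `b_j` iff `i ≤ j`. -/
def halfRel (k : ℕ) : Fin k → Fin k → Prop := fun i j => i ≤ j

/-! Cographs and bi-cographs -/

lemma IsCograph.comap {V W : Type*} {G : SimpleGraph V} (hG : IsCograph G) (f : W → V)
    (hf : Function.Injective f) : IsCograph (G.comap f) := by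
  rintro ⟨g, hg, h⟩
  exact hG ⟨f ∘ g, hf.comp hg, fun u v huv => by simpa using h u v huv⟩

lemma pathG_four_adj (i j : Fin 4) :
    (pathG 4).Adj i j ↔ ((i : ℕ) + 1 = j ∨ (j : ℕ) + 1 = i) := by
  simp only [pathG, SimpleGraph.fromRel_adj]
  constructor
  · exact fun h => h.2
  · intro h
    refine ⟨?_, h⟩
    rintro rfl
    omega

lemma IsCograph.compl {V : Type*} {G : SimpleGraph V} (hG : IsCograph G) : IsCograph Gᶜ := by
  rintro ⟨g, hg, h⟩
  have hσ : Function.Injective (![2, 0, 3, 1] : Fin 4 → Fin 4) := by decide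
  refine hG ⟨g ∘ ![2, 0, 3, 1], hg.comp hσ, fun u v huv => ?_⟩
  have h1 := h _ _ (hσ.ne huv)
  have h2 : g (![2, 0, 3, 1] u) ≠ g (![2, 0, 3, 1] v) := hg.ne (hσ.ne huv)
  rw [SimpleGraph.compl_adj, pathG_four_adj] at h1
  rw [pathG_four_adj]
  have h3 : (¬ (((![2, 0, 3, 1] u : Fin 4) : ℕ) + 1 = (![2, 0, 3, 1] v : Fin 4) ∨
      ((![2, 0, 3, 1] v : Fin 4) : ℕ) + 1 = (![2, 0, 3, 1] u : Fin 4))) ↔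
      ((u : ℕ) + 1 = v ∨ (v : ℕ) + 1 = u) := by
    revert huv; clear h1 h2; revert u v; decide
  simp only [Function.comp_apply]
  tauto

/-- The disjoint union of the graphs `G i`, each restricted to the fibre of `c` over `i`. -/
def fibreUnion {V ι : Type*} (c : V → ι) (G : ι → SimpleGraph V) : SimpleGraph V where
  Adj u v := c u = c v ∧ (G (c u)).Adj u v
  symm := ⟨fun _ _ h => ⟨h.1.symm, h.1 ▸ h.2.symm⟩⟩
  loopless := ⟨fun u h => (G (c u)).loopless.irrefl u h.2⟩

lemma isCograph_fibreUnion {V ι : Type*} (c : V → ι) {G : ι → SimpleGraph V}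
    (hG : ∀ i, IsCograph (G i)) : IsCograph (fibreUnion c G) := by
  rintro ⟨g, hg, h⟩
  have key : ∀ i j : Fin 4, (i : ℕ) + 1 = j → c (g i) = c (g j) := by
    intro i j hij
    have hne : i ≠ j := by rintro rfl; omega
    exact ((h i j hne).2 ((pathG_four_adj i j).2 (Or.inl hij))).1
  have h1 := key 0 1 rfl
  have h2 := key 1 2 rfl
  have h3 := key 2 3 rfl
  have hc : ∀ i, c (g i) = c (g 0) := by
    intro i
    fin_cases i
    · rfl
    · exact h1.symm
    · exact (h1.trans h2).symm
    · exact (h1.trans (h2.trans h3)).symm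
  refine hG (c (g 0)) ⟨g, hg, fun u v huv => ?_⟩
  rw [← h u v huv]
  simp [fibreUnion, hc]

/-- The bipartite graph induced by `R` on `S` and `T` is semi-induced in a cograph. -/
def IsBiCograph {A B : Type*} (R : A → B → Prop) (S : Set A) (T : Set B) : Prop :=
  ∃ H : SimpleGraph (A ⊕ B), IsCograph H ∧
    ∀ a ∈ S, ∀ b ∈ T, H.Adj (Sum.inl a) (Sum.inr b) ↔ R a b

/-- `S` and `T` can each be coloured with `n + 1` colours so that any colour class of `S` together
with any colour class of `T` induces a bi-cograph. -/
def BiCographColorable {A B : Type*} (R : A → B → Prop) (n : ℕ) (S : Set A) (T : Set B) : Prop :=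
  ∃ (cA : A → Fin (n + 1)) (cB : B → Fin (n + 1)), ∀ a b,
    IsBiCograph R {x ∈ S | cA x = cA a} {y ∈ T | cB y = cB b}

section BiCograph

variable {A B : Type*} {R : A → B → Prop} {S S' : Set A} {T T' : Set B} {n m : ℕ}

lemma IsBiCograph.subset (h : IsBiCograph R S T) (hS : S' ⊆ S) (hT : T' ⊆ T) :
    IsBiCograph R S' T' := by
  obtain ⟨H, hH, h⟩ := h
  exact ⟨H, hH, fun a ha b hb => h a (hS ha) b (hT hb)⟩

lemma IsBiCograph.flip (h : IsBiCograph R S T) : IsBiCograph (flip R) T S := by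
  obtain ⟨H, hH, h⟩ := h
  refine ⟨H.comap Sum.swap, hH.comap _ Sum.swap_leftInverse.injective, fun b hb a ha => ?_⟩
  simpa [SimpleGraph.adj_comm, Function.flip_def] using h a ha b hb

lemma IsBiCograph.of_not (h : IsBiCograph (fun a b => ¬ R a b) S T) : IsBiCograph R S T := by
  obtain ⟨H, hH, h⟩ := h
  refine ⟨Hᶜ, hH.compl, fun a ha b hb => ?_⟩
  simp [SimpleGraph.compl_adj, h a ha b hb]

lemma isBiCograph_of_forall_not (h : ∀ a ∈ S, ∀ b ∈ T, ¬ R a b) : IsBiCograph R S T := by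
  refine ⟨⊥, ?_, fun a ha b hb => by simp [h a ha b hb]⟩
  rintro ⟨g, -, hg⟩
  simpa using (hg 0 1 (by decide)).2 ((pathG_four_adj 0 1).2 (Or.inl rfl))

lemma isBiCograph_of_fibres {ι : Type*} (c : A ⊕ B → ι)
    (hc : ∀ a ∈ S, ∀ b ∈ T, R a b → c (Sum.inl a) = c (Sum.inr b))
    (h : ∀ i, IsBiCograph R {a ∈ S | c (Sum.inl a) = i} {b ∈ T | c (Sum.inr b) = i}) :
    IsBiCograph R S T := by
  choose H hH h using h
  refine ⟨fibreUnion c H, isCograph_fibreUnion c hH, fun a ha b hb => ?_⟩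
  constructor
  · rintro ⟨h1, h2⟩
    exact (h _ a ⟨ha, rfl⟩ b ⟨hb, h1.symm⟩).1 h2
  · intro hab
    have h1 := hc a ha b hb hab
    exact ⟨h1, (h _ a ⟨ha, rfl⟩ b ⟨hb, h1.symm⟩).2 hab⟩

lemma BiCographColorable.subset (h : BiCographColorable R n S T) (hS : S' ⊆ S) (hT : T' ⊆ T) :
    BiCographColorable R n S' T' := by
  obtain ⟨cA, cB, h⟩ := h
  exact ⟨cA, cB, fun a b => (h a b).subset (fun x hx => ⟨hS hx.1, hx.2⟩)
    (fun x hx => ⟨hT hx.1, hx.2⟩)⟩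

lemma BiCographColorable.flip (h : BiCographColorable R n S T) :
    BiCographColorable (flip R) n T S := by
  obtain ⟨cA, cB, h⟩ := h
  exact ⟨cB, cA, fun b a => (h a b).flip⟩

lemma BiCographColorable.of_not (h : BiCographColorable (fun a b => ¬ R a b) n S T) :
    BiCographColorable R n S T := by
  obtain ⟨cA, cB, h⟩ := h
  exact ⟨cA, cB, fun a b => (h a b).of_not⟩

lemma BiCographColorable.not (h : BiCographColorable R n S T) :
    BiCographColorable (fun a b => ¬ R a b) n S T :=
  BiCographColorable.of_not (by simpa using h)

lemma biCographColorable_of_forall_not (h : ∀ a ∈ S, ∀ b ∈ T, ¬ R a b) :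
    BiCographColorable R n S T :=
  ⟨fun _ => 0, fun _ => 0, fun _ _ =>
    isBiCograph_of_forall_not fun a ha b hb => h a ha.1 b hb.1⟩

lemma biCographColorable_of_card_le {κ μ : Type*} [Fintype κ] [Fintype μ]
    (hκ : Fintype.card κ ≤ n + 1) (hμ : Fintype.card μ ≤ n + 1) (cA : A → κ) (cB : B → μ)
    (h : ∀ a b, IsBiCograph R {x ∈ S | cA x = cA a} {y ∈ T | cB y = cB b}) :
    BiCographColorable R n S T := by
  obtain ⟨e⟩ := Function.Embedding.nonempty_of_card_le (α := κ) (β := Fin (n + 1)) (by simpa)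
  obtain ⟨e'⟩ := Function.Embedding.nonempty_of_card_le (α := μ) (β := Fin (n + 1)) (by simpa)
  exact ⟨fun a => e (cA a), fun b => e' (cB b), fun a b => by simpa using h a b⟩

lemma BiCographColorable.mono (h : BiCographColorable R n S T) (hnm : n ≤ m) :
    BiCographColorable R m S T := by
  obtain ⟨cA, cB, h⟩ := h
  exact biCographColorable_of_card_le (by simpa) (by simpa) cA cB h

/-- The number of colours sufficient for a union of two coloured sets. -/
def unionBound (n m : ℕ) : ℕ := (n + 1) * (m + 1) + (n + m + 2)

open Classical in
lemma BiCographColorable.union_left {S₁ S₂ : Set A} (h₁ : BiCographColorable R n S₁ T)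
    (h₂ : BiCographColorable R m S₂ T) (hS : S ⊆ S₁ ∪ S₂) :
    BiCographColorable R (unionBound n m) S T := by
  obtain ⟨cA, cB, h₁⟩ := h₁
  obtain ⟨cA', cB', h₂⟩ := h₂
  refine biCographColorable_of_card_le (κ := Fin (n + 1) ⊕ Fin (m + 1))
    (μ := Fin (n + 1) × Fin (m + 1)) ?_ ?_
    (fun a => if a ∈ S₁ then Sum.inl (cA a) else Sum.inr (cA' a)) (fun b => (cB b, cB' b)) ?_
  · simp [unionBound]; omega
  · simp [unionBound]; omega
  · intro a b
    by_cases ha : a ∈ S₁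
    · refine (h₁ a b).subset (fun x hx => ?_) (fun y hy => ⟨hy.1, (Prod.ext_iff.1 hy.2).1⟩)
      have := hx.2
      by_cases hx1 : x ∈ S₁
      · simp only [hx1, ha, if_true] at this
        exact ⟨hx1, Sum.inl.inj this⟩
      · simp [hx1, ha] at this
    · refine (h₂ a b).subset (fun x hx => ?_) (fun y hy => ⟨hy.1, (Prod.ext_iff.1 hy.2).2⟩)
      have := hx.2
      by_cases hx1 : x ∈ S₁
      · simp [hx1, ha] at this
      · simp only [hx1, ha, if_false] at this
        exact ⟨(hS hx.1).resolve_left hx1, Sum.inr.inj this⟩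

lemma BiCographColorable.union_right {T₁ T₂ : Set B} (h₁ : BiCographColorable R n S T₁)
    (h₂ : BiCographColorable R m S T₂) (hT : T ⊆ T₁ ∪ T₂) :
    BiCographColorable R (unionBound n m) S T :=
  (h₁.flip.union_left h₂.flip hT).flip

lemma biCographColorable_of_fibres {ι : Type*} (c : A ⊕ B → ι)
    (hc : ∀ a ∈ S, ∀ b ∈ T, R a b → c (Sum.inl a) = c (Sum.inr b))
    (h : ∀ i, BiCographColorable R n {a ∈ S | c (Sum.inl a) = i}
      {b ∈ T | c (Sum.inr b) = i}) : BiCographColorable R n S T := by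
  choose cA cB h using h
  refine ⟨fun a => cA (c (Sum.inl a)) a, fun b => cB (c (Sum.inr b)) b, fun a b => ?_⟩
  refine isBiCograph_of_fibres c (fun x hx y hy => hc x hx.1 y hy.1) fun i => ?_
  by_cases hA : ∃ x ∈ S, c (Sum.inl x) = i ∧ cA i x = cA (c (Sum.inl a)) a
  · by_cases hB : ∃ y ∈ T, c (Sum.inr y) = i ∧ cB i y = cB (c (Sum.inr b)) b
    · obtain ⟨x, -, -, hx⟩ := hA
      obtain ⟨y, -, -, hy⟩ := hB
      refine (h i x y).subset ?_ ?_
      · rintro z ⟨⟨hz, hz'⟩, rfl⟩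
        exact ⟨⟨hz, rfl⟩, hz'.trans hx.symm⟩
      · rintro z ⟨⟨hz, hz'⟩, rfl⟩
        exact ⟨⟨hz, rfl⟩, hz'.trans hy.symm⟩
    · refine isBiCograph_of_forall_not fun x _ y hy _ => hB ⟨y, hy.1.1, hy.2, ?_⟩
      rw [← hy.2]
      exact hy.1.2
  · refine isBiCograph_of_forall_not fun x hx _ _ _ => hA ⟨x, hx.1.1, hx.2, ?_⟩
    rw [← hx.2]
    exact hx.1.2

/-- Colouring after deletion of a vertex `b` and its neighbourhood. -/
lemma BiCographColorable.add_vertex {b : B}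
    (h : BiCographColorable R n {a ∈ S | ¬ R a b} {y ∈ T | y ≠ b})
    (hb : BiCographColorable R m {a ∈ S | R a b} T) :
    BiCographColorable R (unionBound (unionBound n 0) m) S T := by
  have h0 : BiCographColorable R 0 {a ∈ S | ¬ R a b} {b} :=
    biCographColorable_of_forall_not fun a ha y hy => by
      rw [Set.mem_singleton_iff.1 hy]; exact ha.2
  have h1 : BiCographColorable R (unionBound n 0) {a ∈ S | ¬ R a b} T :=
    h.union_right h0 fun y hy => by
      by_cases hyb : y = b
      · exact Or.inr hyb
      · exact Or.inl ⟨hy, hyb⟩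
  exact h1.union_left hb fun a ha => by
    by_cases hab : R a b
    · exact Or.inr ⟨ha, hab⟩
    · exact Or.inl ⟨ha, hab⟩

end BiCograph

/-! Induced paths -/

section Paths

variable {A B : Type*} {R : A → B → Prop}

/-- The adjacency relation on `A ⊕ B` of the bipartite graph given by `R`. -/
def bipAdj (R : A → B → Prop) : A ⊕ B → A ⊕ B → Prop
  | Sum.inl a, Sum.inr b => R a b
  | Sum.inr b, Sum.inl a => R a b
  | _, _ => False

lemma bipAdj_comm (u v : A ⊕ B) : bipAdj R u v ↔ bipAdj R v u := by
  rcases u with u | u <;> rcases v with v | v <;> rfl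

lemma bipAdj_irrefl (u : A ⊕ B) : ¬ bipAdj R u u := by
  rcases u with u | u <;> exact id

lemma isLeft_of_bipAdj {u v : A ⊕ B} (h : bipAdj R u v) : v.isLeft = !u.isLeft := by
  rcases u with u | u <;> rcases v with v | v <;> first | rfl | exact h.elim

/-- There is an induced path with `j` edges starting at `v` whose other vertices lie in `W`. -/
def HasInducedPath {V : Type*} (E : V → V → Prop) : ℕ → V → Set V → Prop
  | 0, _, _ => True
  | j + 1, v, W => ∃ u ∈ W, E v u ∧ HasInducedPath E j u {w ∈ W | ¬ E v w ∧ w ≠ v}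

lemma HasInducedPath.mono {V : Type*} {E : V → V → Prop} {j : ℕ} {v : V} {W W' : Set V}
    (h : HasInducedPath E j v W) (hW : W ⊆ W') : HasInducedPath E j v W' := by
  induction j generalizing v W W' with
  | zero => trivial
  | succ j ih =>
    obtain ⟨u, hu, hvu, h⟩ := h
    exact ⟨u, hW hu, hvu, ih h fun w hw => ⟨hW hw.1, hw.2⟩⟩

lemma HasInducedPath.exists_seq {V : Type*} {E : V → V → Prop} (hE : ∀ v, ¬ E v v) {j : ℕ} {v : V}
    {W : Set V} (h : HasInducedPath E j v W) :
    ∃ p : ℕ → V, p 0 = v ∧ (∀ i, i < j → p (i + 1) ∈ W) ∧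
      ∀ i i', i < i' → i' ≤ j → p i ≠ p i' ∧ (E (p i) (p i') ↔ i' = i + 1) := by
  induction j generalizing v W with
  | zero => exact ⟨fun _ => v, rfl, by simp, fun i i' h1 h2 => by omega⟩
  | succ j ih =>
    obtain ⟨u, hu, hvu, h⟩ := h
    obtain ⟨p, hp0, hpW, hp⟩ := ih h
    refine ⟨fun i => Nat.casesOn i v p, rfl, ?_, ?_⟩
    · rintro (_ | i) hi
      · simpa [hp0] using hu
      · exact (hpW i (by omega)).1
    · rintro (_ | i) (_ | i') h1 h2
      · omega
      · rcases i' with _ | i'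
        · simp only [hp0]
          refine ⟨?_, by simpa using hvu⟩
          rintro rfl
          exact hE _ hvu
        · have := (hpW i' (by omega)).2
          exact ⟨this.2.symm, by simpa using this.1⟩
      · omega
      · have := hp i i' (by omega) (by omega)
        simpa using this

lemma bipContains_pathBipRel {t : ℕ} {v : A ⊕ B} {W : Set (A ⊕ B)}
    (h : HasInducedPath (bipAdj R) t v W) : BipContains (pathBipRel t) R := by
  obtain ⟨p, hp0, -, hp⟩ := h.exists_seq bipAdj_irrefl
  have hinj : ∀ i i', i ≤ t → i' ≤ t → p i = p i' → i = i' := by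
    intro i i' hi hi' heq
    rcases lt_trichotomy i i' with hlt | rfl | hlt
    · exact ((hp _ _ hlt hi').1 heq).elim
    · rfl
    · exact ((hp _ _ hlt hi).1 heq.symm).elim
  have hadj : ∀ i i', i ≤ t → i' ≤ t → (bipAdj R (p i) (p i') ↔ i + 1 = i' ∨ i' + 1 = i) := by
    intro i i' hi hi'
    rcases lt_trichotomy i i' with hlt | rfl | hlt
    · rw [(hp _ _ hlt hi').2]; omega
    · simp [bipAdj_irrefl]
    · rw [bipAdj_comm, (hp _ _ hlt hi).2]; omega
  have hside : ∀ i, i ≤ t → (p i).isLeft = if i % 2 = 0 then v.isLeft else !v.isLeft := by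
    intro i
    induction i with
    | zero => simp [hp0]
    | succ i ih =>
      intro hi
      rw [isLeft_of_bipAdj ((hadj i (i + 1) (by omega) hi).2 (Or.inl rfl)), ih (by omega)]
      rcases Nat.mod_two_eq_zero_or_one i with h0 | h0
      · simp [h0, Nat.add_mod]
      · simp [h0, Nat.add_mod]
  rcases v with v | v
  · have hl : ∀ x : {i : Fin t // i.val % 2 = 0}, ∃ a, p x.val.val = Sum.inl a := fun x => by
      have := hside x.val.val (by omega)
      simpa [x.2, Sum.isLeft_iff] using this
    have hr : ∀ x : {i : Fin t // i.val % 2 = 1}, ∃ b, p x.val.val = Sum.inr b := fun x => by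
      have := hside x.val.val (by omega)
      simpa [x.2, Sum.isRight_iff] using this
    choose f hf using hl
    choose g hg using hr
    refine Or.inl ⟨f, g, fun x y hxy => ?_, fun x y hxy => ?_, fun x y => ?_⟩
    · exact Subtype.ext (Fin.ext (hinj _ _ (by omega) (by omega) (by rw [hf, hf, hxy])))
    · exact Subtype.ext (Fin.ext (hinj _ _ (by omega) (by omega) (by rw [hg, hg, hxy])))
    · have := hadj x.val.val y.val.val (by omega) (by omega)
      rw [hf, hg] at this
      exact this
  · have hl : ∀ x : {i : Fin t // i.val % 2 = 0}, ∃ b, p x.val.val = Sum.inr b := fun x => by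
      have := hside x.val.val (by omega)
      simpa [x.2, Sum.isRight_iff] using this
    have hr : ∀ x : {i : Fin t // i.val % 2 = 1}, ∃ a, p x.val.val = Sum.inl a := fun x => by
      have := hside x.val.val (by omega)
      simpa [x.2, Sum.isLeft_iff] using this
    choose f hf using hl
    choose g hg using hr
    refine Or.inr ⟨f, g, fun x y hxy => ?_, fun x y hxy => ?_, fun x y => ?_⟩
    · exact Subtype.ext (Fin.ext (hinj _ _ (by omega) (by omega) (by rw [hf, hf, hxy])))
    · exact Subtype.ext (Fin.ext (hinj _ _ (by omega) (by omega) (by rw [hg, hg, hxy])))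
    · have := hadj x.val.val y.val.val (by omega) (by omega)
      rw [hf, hg] at this
      exact this

end Paths

/-! Reachability inside a set of vertices -/

section Reach

variable {V : Type*} {E : V → V → Prop} {W : Set V} {u v w : V}

/-- `w` can be reached from `v` by a walk all of whose vertices after `v` lie in `W`. -/
def ReachIn (E : V → V → Prop) (W : Set V) : V → V → Prop :=
  Relation.ReflTransGen fun x y => E x y ∧ y ∈ W

lemma ReachIn.symm (hE : ∀ x y, E x y → E y x) (h : ReachIn E W v w) (hv : v ∈ W) :
    ReachIn E W w v := by
  suffices w ∈ W ∧ ReachIn E W w v from this.2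
  induction h with
  | refl => exact ⟨hv, .refl⟩
  | tail _ hyz ih => exact ⟨hyz.2, .head ⟨hE _ _ hyz.1, ih.1⟩ ih.2⟩

lemma ReachIn.reachIn_reachable (h : ReachIn E W v w) :
    ReachIn E {x ∈ W | ReachIn E W v x} v w := by
  induction h with
  | refl => exact .refl
  | tail hxy hyz ih => exact .tail ih ⟨hyz.1, hyz.2, .tail hxy hyz⟩

lemma ReachIn.exists_neighbor (h : ReachIn E W v w) (hw : ¬ E v w ∧ w ≠ v) :
    ∃ u ∈ W, E v u ∧ ReachIn E {x ∈ W | ¬ E v x ∧ x ≠ v} u w := by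
  induction h with
  | refl => exact (hw.2 rfl).elim
  | @tail y z _ hyz ih =>
    by_cases hyv : y = v
    · subst hyv
      exact (hw.1 hyz.1).elim
    · by_cases hvy : E v y
      · rename_i hvy'
        have hy : y ∈ W := by
          rcases hvy'.cases_tail with h0 | ⟨_, _, h0⟩
          · exact (hyv h0).elim
          · exact h0.2
        exact ⟨y, hy, hvy, .single ⟨hyz.1, hyz.2, hw⟩⟩
      · obtain ⟨u, hu, hvu, h⟩ := ih ⟨hvy, hyv⟩
        exact ⟨u, hu, hvu, .tail h ⟨hyz.1, hyz.2, hw⟩⟩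

end Reach

section Sparse

variable {A B : Type*} {R : A → B → Prop} {n : ℕ}

lemma biCographColorable_of_reachable {W : Set (A ⊕ B)}
    (h : ∀ w ∈ W, BiCographColorable R n
      (Sum.inl ⁻¹' {x ∈ W | ReachIn (bipAdj R) W w x})
      (Sum.inr ⁻¹' {x ∈ W | ReachIn (bipAdj R) W w x})) :
    BiCographColorable R n (Sum.inl ⁻¹' W) (Sum.inr ⁻¹' W) := by
  have hsymm : ∀ x y, bipAdj R x y → bipAdj R y x := fun x y => (bipAdj_comm x y).1
  refine biCographColorable_of_fibres (fun w => {x ∈ W | ReachIn (bipAdj R) W w x}) ?_ ?_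
  · intro a ha b hb hab
    have h1 : ReachIn (bipAdj R) W (Sum.inl a) (Sum.inr b) := .single ⟨hab, hb⟩
    have h2 := h1.symm hsymm ha
    ext x
    exact and_congr_right fun _ => ⟨fun h => h2.trans h, fun h => h1.trans h⟩
  · intro C
    by_cases hC : ∃ w ∈ W, {x ∈ W | ReachIn (bipAdj R) W w x} = C
    · obtain ⟨w, hw, rfl⟩ := hC
      refine (h w hw).subset ?_ ?_
      · rintro a ⟨ha, heq⟩
        have : Sum.inl a ∈ {x ∈ W | ReachIn (bipAdj R) W (Sum.inl a) x} := ⟨ha, .refl⟩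
        exact heq ▸ this
      · rintro b ⟨hb, heq⟩
        have : Sum.inr b ∈ {x ∈ W | ReachIn (bipAdj R) W (Sum.inr b) x} := ⟨hb, .refl⟩
        exact heq ▸ this
    · exact biCographColorable_of_forall_not fun a ha _ _ _ => hC ⟨_, ha.1, ha.2⟩

/-- The Gyárfás path argument: if deleting a vertex and its neighbourhood never decreases the
number of colours by much, then many colours force a long induced path. -/
lemma biCographColorable_of_not_hasInducedPath {W₀ : Set (A ⊕ B)} {f : ℕ → ℕ}
    (hf : ∀ v ∈ W₀, ∀ W ⊆ W₀, ∀ n,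
      BiCographColorable R n (Sum.inl ⁻¹' {w ∈ W | ¬ bipAdj R v w ∧ w ≠ v})
        (Sum.inr ⁻¹' {w ∈ W | ¬ bipAdj R v w ∧ w ≠ v}) →
      BiCographColorable R (f n) (Sum.inl ⁻¹' W) (Sum.inr ⁻¹' W))
    (j : ℕ) {v : A ⊕ B} (hv : v ∈ W₀) {W : Set (A ⊕ B)} (hW : W ⊆ W₀)
    (hreach : ∀ w ∈ W, ReachIn (bipAdj R) W v w)
    (hpath : ¬ HasInducedPath (bipAdj R) j v W) :
    BiCographColorable R (f^[j] 0) (Sum.inl ⁻¹' W) (Sum.inr ⁻¹' W) := by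
  induction j generalizing v W with
  | zero => exact (hpath trivial).elim
  | succ j ih =>
    rw [Function.iterate_succ_apply']
    refine hf v hv W hW _ (biCographColorable_of_reachable fun w hw => ?_)
    obtain ⟨u, hu, hvu, hwu⟩ := (hreach w hw.1).exists_neighbor hw.2
    have hX := ih (hW hu) (W := {x ∈ {w ∈ W | ¬ bipAdj R v w ∧ w ≠ v} |
        ReachIn (bipAdj R) {w ∈ W | ¬ bipAdj R v w ∧ w ≠ v} u x})
      (fun x hx => hW hx.1.1) (fun x hx => hx.2.reachIn_reachable)
      (fun hp => hpath ⟨u, hu, hvu, hp.mono fun x hx => hx.1⟩)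
    exact hX.subset (fun x hx => ⟨hx.1, hwu.trans hx.2⟩) (fun x hx => ⟨hx.1, hwu.trans hx.2⟩)

/-- Colouring when all neighbourhoods are easily coloured and there are no long induced paths. -/
lemma biCographColorable_of_sparse {S : Set A} {T : Set B} {t : ℕ}
    (hS : ∀ a ∈ S, BiCographColorable R n S {b ∈ T | R a b})
    (hT : ∀ b ∈ T, BiCographColorable R n {a ∈ S | R a b} T)
    (hpath : ∀ v W, ¬ HasInducedPath (bipAdj R) t v W) :
    BiCographColorable R ((fun m => unionBound (unionBound m 0) n)^[t] 0) S T := by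
  let W₀ : Set (A ⊕ B) := {w | Sum.elim (· ∈ S) (· ∈ T) w}
  change BiCographColorable R _ (Sum.inl ⁻¹' W₀) (Sum.inr ⁻¹' W₀)
  refine biCographColorable_of_reachable fun w hw => ?_
  refine biCographColorable_of_not_hasInducedPath (W₀ := W₀) ?_ t hw (fun x hx => hx.1)
    (fun x hx => hx.2.reachIn_reachable) (hpath _ _)
  rintro (a | b) hv W hW m h
  · refine BiCographColorable.flip (R := flip R) (BiCographColorable.add_vertex (b := a) ?_ ?_)
    · refine h.flip.subset (fun y hy => ?_) (fun x hx => ?_)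
      · exact ⟨hy.1, hy.2, by simp⟩
      · exact ⟨hx.1, id, by simpa using hx.2⟩
    · exact (hS a hv).flip.subset (fun y hy => ⟨hW hy.1, hy.2⟩) (fun x hx => hW hx)
  · refine BiCographColorable.add_vertex (b := b) ?_ ?_
    · refine h.subset (fun y hy => ?_) (fun x hx => ?_)
      · exact ⟨hy.1, hy.2, by simp⟩
      · exact ⟨hx.1, id, by simpa using hx.2⟩
    · exact (hT b hv).subset (fun y hy => ⟨hW hy.1, hy.2⟩) (fun x hx => hW hx)

end Sparse

/-! Half-graphs and shattered trees -/

section HalfGraph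

variable {A B : Type*} {R : A → B → Prop} {S S' : Set A} {T T' : Set B} {n m : ℕ}

/-- There are `a₁, …, aₙ ∈ S` and `b₁, …, bₙ ∈ T` with `R aᵢ bⱼ` iff `i ≤ j`. -/
def HasHalfGraph (R : A → B → Prop) : ℕ → Set A → Set B → Prop
  | 0, _, _ => True
  | n + 1, S, T => ∃ a ∈ S, ∃ b ∈ T, R a b ∧ HasHalfGraph R n {x ∈ S | ¬ R x b} {y ∈ T | R a y}

lemma HasHalfGraph.mono (h : HasHalfGraph R n S T) (hS : S ⊆ S') (hT : T ⊆ T') :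
    HasHalfGraph R n S' T' := by
  induction n generalizing S S' T T' with
  | zero => trivial
  | succ n ih =>
    obtain ⟨a, ha, b, hb, hab, h⟩ := h
    exact ⟨a, hS ha, b, hT hb, hab, ih h (fun x hx => ⟨hS hx.1, hx.2⟩)
      (fun x hx => ⟨hT hx.1, hx.2⟩)⟩

lemma HasHalfGraph.of_succ (h : HasHalfGraph R (n + 1) S T) : HasHalfGraph R n S T := by
  induction n generalizing S T with
  | zero => trivial
  | succ n ih =>
    obtain ⟨a, ha, b, hb, hab, h⟩ := h
    exact ⟨a, ha, b, hb, hab, ih h⟩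

lemma HasHalfGraph.exists_seq (h : HasHalfGraph R n S T) :
    ∃ (f : Fin n → A) (g : Fin n → B), (∀ i, f i ∈ S) ∧ (∀ i, g i ∈ T) ∧
      ∀ i j, R (f i) (g j) ↔ i ≤ j := by
  induction n generalizing S T with
  | zero => exact ⟨Fin.elim0, Fin.elim0, fun i => i.elim0, fun i => i.elim0, fun i => i.elim0⟩
  | succ n ih =>
    obtain ⟨a, ha, b, hb, hab, h⟩ := h
    obtain ⟨f, g, hf, hg, h⟩ := ih h
    refine ⟨Fin.cons a f, Fin.cons b g, fun i => ?_, fun i => ?_, fun i j => ?_⟩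
    · refine Fin.cases ha (fun i => ?_) i
      exact (hf i).1
    · refine Fin.cases hb (fun i => ?_) i
      exact (hg i).1
    · refine Fin.cases ?_ (fun i => ?_) i <;> refine Fin.cases ?_ (fun j => ?_) j
      · simpa using hab
      · simpa using (hg j).2
      · simpa using (hf i).2
      · simpa using h i j

lemma HasHalfGraph.bipContains (h : HasHalfGraph R n S T) : BipContains (halfRel n) R := by
  obtain ⟨f, g, -, -, h⟩ := h.exists_seq
  refine Or.inl ⟨f, g, fun i j hij => ?_, fun i j hij => ?_, h⟩
  · exact le_antisymm ((h i j).1 (hij ▸ (h j j).2 le_rfl)) ((h j i).1 (hij ▸ (h i i).2 le_rfl))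
  · exact le_antisymm ((h i j).1 (hij ▸ (h i i).2 le_rfl)) ((h j i).1 (hij ▸ (h j j).2 le_rfl))

lemma HasHalfGraph.bipContains_of_not (h : HasHalfGraph (fun a b => ¬ R a b) (n + 1) S T) :
    BipContains (halfRel n) R := by
  obtain ⟨f, g, -, -, h⟩ := h.exists_seq
  have h' : ∀ i j : Fin n, R (f j.succ) (g i.castSucc) ↔ i ≤ j := fun i j => by
    rw [← not_iff_not, h, Fin.succ_le_castSucc_iff, not_le]
  refine Or.inr ⟨fun i => g i.castSucc, fun j => f j.succ, fun i j hij => ?_, fun i j hij => ?_, h'⟩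
  · exact le_antisymm ((h' i j).1 (by simpa only [hij] using (h' j j).2 le_rfl))
      ((h' j i).1 (by simpa only [← hij] using (h' i i).2 le_rfl))
  · exact le_antisymm ((h' i j).1 (by simpa only [← hij] using (h' i i).2 le_rfl))
      ((h' j i).1 (by simpa only [hij] using (h' j j).2 le_rfl))

/-- There is a full binary tree of height `n` with nodes labelled by `T`, all of whose branches
are realised by elements of `S`. -/
def Shatters (R : A → B → Prop) : ℕ → Set A → Set B → Prop
  | 0, S, _ => S.Nonempty
  | n + 1, S, T => ∃ b ∈ T, Shatters R n {a ∈ S | R a b} T ∧ Shatters R n {a ∈ S | ¬ R a b} T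

lemma Shatters.mono (h : Shatters R n S T) (hS : S ⊆ S') (hT : T ⊆ T') : Shatters R n S' T' := by
  induction n generalizing S S' with
  | zero => exact Set.Nonempty.mono hS h
  | succ n ih =>
    obtain ⟨b, hb, h1, h2⟩ := h
    exact ⟨b, hT hb, ih h1 fun x hx => ⟨hS hx.1, hx.2⟩, ih h2 fun x hx => ⟨hS hx.1, hx.2⟩⟩

lemma Shatters.nonempty (h : Shatters R n S T) : S.Nonempty := by
  induction n generalizing S with
  | zero => exact h
  | succ n ih =>
    obtain ⟨b, -, h1, -⟩ := h
    exact (ih h1).mono fun x hx => hx.1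

lemma Shatters.split {T₁ T₂ : Set B} (h : Shatters R (n + m) S T) (hT : T ⊆ T₁ ∪ T₂) :
    Shatters R n S T₁ ∨ Shatters R m S T₂ := by
  induction hk : n + m generalizing S n m with
  | zero =>
    obtain rfl : n = 0 := by omega
    exact Or.inl h.nonempty
  | succ k ih =>
    rcases n with _ | n
    · exact Or.inl h.nonempty
    rcases m with _ | m
    · exact Or.inr h.nonempty
    rw [hk] at h
    obtain ⟨b, hb, h1, h2⟩ := h
    rcases hT hb with hb' | hb'
    · obtain rfl : k = n + (m + 1) := by omega
      rcases ih h1 rfl with h1 | h1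
      · rcases ih h2 rfl with h2 | h2
        · exact Or.inl ⟨b, hb', h1, h2⟩
        · exact Or.inr (h2.mono (fun x hx => hx.1) subset_rfl)
      · exact Or.inr (h1.mono (fun x hx => hx.1) subset_rfl)
    · obtain rfl : k = (n + 1) + m := by omega
      rcases ih h1 rfl with h1 | h1
      · exact Or.inl (h1.mono (fun x hx => hx.1) subset_rfl)
      · rcases ih h2 rfl with h2 | h2
        · exact Or.inl (h2.mono (fun x hx => hx.1) subset_rfl)
        · exact Or.inr ⟨b, hb', h1, h2⟩

/-- The height of a shattered tree guaranteeing a half-graph in the lemma of Hodges. -/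
def treeBound : ℕ → ℕ
  | 0 => 0
  | s + 1 => (treeBound s + 1) + (treeBound s + 1)

/-- Lemma of Hodges: tall shattered trees yield long half-graphs. -/
lemma Shatters.hasHalfGraph {p q : ℕ} (h : Shatters R (treeBound (p + q)) S T) :
    HasHalfGraph R p S T ∨ HasHalfGraph (fun a b => ¬ R a b) q S T := by
  induction hs : p + q generalizing p q S T with
  | zero =>
    obtain rfl : p = 0 := by omega
    exact Or.inl trivial
  | succ s ih =>
    rcases p with _ | p
    · exact Or.inl trivial
    rcases q with _ | q
    · exact Or.inr trivial
    obtain ⟨a, ha⟩ := h.nonempty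
    rw [hs] at h
    rcases h.split (T₁ := {y ∈ T | R a y}) (T₂ := {y ∈ T | ¬ R a y})
      (fun y hy => (em (R a y)).imp (⟨hy, ·⟩) (⟨hy, ·⟩)) with h | h
    · obtain ⟨b, hb, -, h⟩ := h
      obtain rfl : s = p + (q + 1) := by omega
      rcases ih h rfl with h | h
      · exact Or.inl ⟨a, ha, b, hb.1, hb.2, h⟩
      · exact Or.inr (h.mono (fun x hx => hx.1) (fun y hy => hy.1))
    · obtain ⟨b, hb, h, -⟩ := h
      obtain rfl : s = p + 1 + q := by omega
      rcases ih h rfl with h | h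
      · exact Or.inl (h.mono (fun x hx => hx.1) (fun y hy => hy.1))
      · exact Or.inr ⟨a, ha, b, hb.1, hb.2, by simpa using h⟩

/-- Colouring when vertices in `S` have easily coloured neighbourhoods, vertices in `T` have easily
coloured non-neighbourhoods, and there are no long half-graphs. -/
lemma biCographColorable_of_mixed {k : ℕ}
    (hS : ∀ a ∈ S, BiCographColorable R n S {b ∈ T | R a b})
    (hT : ∀ b ∈ T, BiCographColorable R n {a ∈ S | ¬ R a b} T)
    (hk : ¬ HasHalfGraph (fun a b => ¬ R a b) k S T) :
    BiCographColorable R ((fun m => unionBound (unionBound m n) n)^[k] 0) S T := by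
  induction k generalizing S T with
  | zero => exact (hk trivial).elim
  | succ k ih =>
    by_cases hab : ∃ a ∈ S, ∃ b ∈ T, ¬ R a b
    · obtain ⟨a, ha, b, hb, hab⟩ := hab
      rw [Function.iterate_succ_apply']
      have h := ih (S := {x ∈ S | ¬ ¬ R x b}) (T := {y ∈ T | ¬ R a y})
        (fun x hx => (hS x hx.1).subset (fun z hz => hz.1) (fun z hz => ⟨hz.1.1, hz.2⟩))
        (fun y hy => (hT y hy.1).subset (fun z hz => ⟨hz.1.1, hz.2⟩) (fun z hz => hz.1))
        (fun h => hk ⟨a, ha, b, hb, hab, h⟩)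
      have h' : BiCographColorable R _ {x ∈ S | ¬ ¬ R x b} T :=
        h.union_right ((hS a ha).subset (fun x hx => hx.1) subset_rfl)
          (fun y hy => (em (R a y)).symm.imp (⟨hy, ·⟩) (⟨hy, ·⟩))
      exact h'.union_left (hT b hb) fun x hx => (em (¬ R x b)).symm.imp (⟨hx, ·⟩) (⟨hx, ·⟩)
    · push Not at hab
      exact BiCographColorable.of_not
        (biCographColorable_of_forall_not fun a ha b hb => not_not.2 (hab a ha b hb))

end HalfGraph

/-- Bipartite graphs excluding long paths, their bipartite complements and long half-graphs
can be coloured with a number of colours bounded in terms of the heights of shattered trees. -/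
lemma exists_biCographColorable_of_not_shatters (t k dA dB : ℕ) :
    ∃ n, ∀ {A B : Type} (R : A → B → Prop) (S : Set A) (T : Set B),
      (∀ v W, ¬ HasInducedPath (bipAdj R) t v W) →
      (∀ v W, ¬ HasInducedPath (bipAdj fun a b => ¬ R a b) t v W) →
      (∀ S T, ¬ HasHalfGraph R k S T) →
      (∀ S T, ¬ HasHalfGraph (fun a b => ¬ R a b) k S T) →
      ¬ Shatters R dA S T → ¬ Shatters (flip R) dB T S → BiCographColorable R n S T := by
  induction dA generalizing dB with
  | zero =>
    exact ⟨0, fun R S T _ _ _ _ h _ =>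
      biCographColorable_of_forall_not fun a ha => (h ⟨a, ha⟩).elim⟩
  | succ dA ihA =>
    induction dB with
    | zero =>
      exact ⟨0, fun R S T _ _ _ _ _ h =>
        biCographColorable_of_forall_not fun a ha b hb => (h ⟨b, hb⟩).elim⟩
    | succ dB ihB =>
      obtain ⟨n₁, h₁⟩ := ihA (dB + 1)
      obtain ⟨n₂, h₂⟩ := ihB
      let n := max n₁ n₂
      let s := (fun m => unionBound (unionBound m 0) n)^[t] 0
      let d := (fun m => unionBound (unionBound m n) n)^[k] 0
      refine ⟨unionBound (unionBound s d) (unionBound d s), ?_⟩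
      intro A B R S T hp hp' hk hk' hA hB
      let S₁ : Set A := {a ∈ S | BiCographColorable R n S {b ∈ T | R a b}}
      let S₂ : Set A := {a ∈ S | BiCographColorable R n S {b ∈ T | ¬ R a b}}
      let T₁ : Set B := {b ∈ T | BiCographColorable R n {a ∈ S | R a b} T}
      let T₂ : Set B := {b ∈ T | BiCographColorable R n {a ∈ S | ¬ R a b} T}
      have hS : S ⊆ S₁ ∪ S₂ := by
        intro a ha
        by_cases h : Shatters (flip R) dB {b ∈ T | R a b} S
        · refine Or.inr ⟨ha, (h₂ R _ _ hp hp' hk hk' ?_ ?_).mono (le_max_right _ _)⟩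
          · exact fun h' => hA (h'.mono subset_rfl fun y hy => hy.1)
          · exact fun h' => hB ⟨a, ha, h, h'⟩
        · refine Or.inl ⟨ha, (h₂ R _ _ hp hp' hk hk' ?_ h).mono (le_max_right _ _)⟩
          exact fun h' => hA (h'.mono subset_rfl fun y hy => hy.1)
      have hT : T ⊆ T₁ ∪ T₂ := by
        intro b hb
        by_cases h : Shatters R dA {a ∈ S | R a b} T
        · refine Or.inr ⟨hb, (h₁ R _ _ hp hp' hk hk' ?_ ?_).mono (le_max_left _ _)⟩
          · exact fun h' => hA ⟨b, hb, h, h'⟩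
          · exact fun h' => hB (h'.mono subset_rfl fun y hy => hy.1)
        · refine Or.inl ⟨hb, (h₁ R _ _ hp hp' hk hk' h ?_).mono (le_max_left _ _)⟩
          exact fun h' => hB (h'.mono subset_rfl fun y hy => hy.1)
      have h11 : BiCographColorable R s S₁ T₁ := biCographColorable_of_sparse
        (fun a ha => ha.2.subset (fun x hx => hx.1) (fun y hy => ⟨hy.1.1, hy.2⟩))
        (fun b hb => hb.2.subset (fun x hx => ⟨hx.1.1, hx.2⟩) (fun y hy => hy.1)) hp
      have h22 : BiCographColorable R s S₂ T₂ := .of_not <| biCographColorable_of_sparse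
        (fun a ha => (ha.2.subset (fun x hx => hx.1) (fun y hy => ⟨hy.1.1, hy.2⟩)).not)
        (fun b hb => (hb.2.subset (fun x hx => ⟨hx.1.1, hx.2⟩) (fun y hy => hy.1)).not) hp'
      have h12 : BiCographColorable R d S₁ T₂ := biCographColorable_of_mixed
        (fun a ha => ha.2.subset (fun x hx => hx.1) (fun y hy => ⟨hy.1.1, hy.2⟩))
        (fun b hb => hb.2.subset (fun x hx => ⟨hx.1.1, hx.2⟩) (fun y hy => hy.1)) (hk' _ _)
      have h21 : BiCographColorable R d S₂ T₁ := .of_not <| biCographColorable_of_mixed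
        (fun a ha => (ha.2.subset (fun x hx => hx.1) (fun y hy => ⟨hy.1.1, hy.2⟩)).not)
        (fun b hb => (hb.2.subset (fun x hx => ⟨hx.1.1, not_not.1 hx.2⟩) (fun y hy => hy.1)).not)
        (by simpa using hk _ _)
      exact (h11.union_right h12 hT).union_left (h21.union_right h22 hT) hS

theorem stmt3 (t k : ℕ) (ht : 1 ≤ t) (hk : 1 ≤ k) :
    ∃ N : ℕ, ∀ (A B : Type) (_ : Fintype A) (_ : Fintype B) (R : A → B → Prop),
      ¬ BipContains (pathBipRel t) R →
      ¬ BipContains (fun x y => ¬ pathBipRel t x y) R →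
      ¬ BipContains (halfRel k) R →
      ∃ (p q : ℕ) (cA : A → Fin p) (cB : B → Fin q),
        p + q ≤ N ∧
        ∀ (i : Fin p) (j : Fin q),
          ∃ H : SimpleGraph ({a : A // cA a = i} ⊕ {b : B // cB b = j}),
            IsCograph H ∧
            ∀ (x : {a : A // cA a = i}) (y : {b : B // cB b = j}),
              H.Adj (Sum.inl x) (Sum.inr y) ↔ R x.val y.val := by
  obtain ⟨n, hn⟩ := exists_biCographColorable_of_not_shatters t (k + 1)
    (treeBound ((k + 1) + (k + 1))) (treeBound ((k + 1) + (k + 1)))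
  refine ⟨(n + 1) + (n + 1), fun A B _ _ R hP hP' hH => ?_⟩
  have hk : ∀ S T, ¬ HasHalfGraph R (k + 1) S T := fun S T h => hH h.of_succ.bipContains
  have hk' : ∀ S T, ¬ HasHalfGraph (fun a b => ¬ R a b) (k + 1) S T :=
    fun S T h => hH h.bipContains_of_not
  have hflip : ¬ BipContains (halfRel k) (flip R) := fun h => hH h.symm
  have hp' : ∀ v W, ¬ HasInducedPath (bipAdj fun a b => ¬ R a b) t v W := by
    intro v W h
    refine hP' ((bipContains_pathBipRel h).imp ?_ ?_)
    · rintro ⟨f, g, hf, hg, h⟩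
      exact ⟨f, g, hf, hg, fun x y => (not_iff_comm.1 (h x y)).symm⟩
    · rintro ⟨f, g, hf, hg, h⟩
      exact ⟨f, g, hf, hg, fun x y => (not_iff_comm.1 (h x y)).symm⟩
  obtain ⟨cA, cB, hc⟩ := hn R Set.univ Set.univ (fun v W h => hP (bipContains_pathBipRel h)) hp'
    hk hk' (fun h => h.hasHalfGraph.elim (hk _ _) (hk' _ _))
    (fun h => h.hasHalfGraph.elim (fun h => hflip h.of_succ.bipContains)
      (fun h => hflip h.bipContains_of_not))
  refine ⟨n + 1, n + 1, cA, cB, le_rfl, fun i j => ?_⟩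
  have hij : IsBiCograph R {a | cA a = i} {b | cB b = j} := by
    by_cases hi : ∃ a, cA a = i
    · by_cases hj : ∃ b, cB b = j
      · obtain ⟨a, rfl⟩ := hi
        obtain ⟨b, rfl⟩ := hj
        simpa using hc a b
      · exact isBiCograph_of_forall_not fun _ _ b hb => (hj ⟨b, hb⟩).elim
    · exact isBiCograph_of_forall_not fun a ha => (hi ⟨a, ha⟩).elim
  obtain ⟨H, hH, h⟩ := hij
  exact ⟨H.comap (Sum.map Subtype.val Subtype.val),
    hH.comap _ (Subtype.val_injective.sumMap Subtype.val_injective),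
    fun x y => h x.1 x.2 y.1 y.2⟩
end
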